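/- arXiv:2508.17743 — 2 statements merged into one kernel-verified Lean document; each statement's English description precedes it below -/
import Mathlib

section
/- Let G be a simple graph on a finite vertex type and let e = uv be an edge of G. Then the characteristic polynomial of the Laplacian matrix satisfies φ(L(G)) = φ(L(G − e)) − φ(L_u(G − e)) − φ(L_v(G − e)) − 2·Σ_{C ∈ 𝔠_G(e)} (−1)^{|V(C)|}·φ(L_{V(C)}(G)). -/
open Polynomial Matrix

attribute [local instance] Classical.propDecidable

noncomputable section

/-- The permanent of a square matrix: `per M = ∑_{σ} ∏_i M i (σ i)`. -/
def Matrix.per {n R : Type*} [Fintype n] [DecidableEq n] [CommRing R]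
    (M : Matrix n n R) : R :=
  ∑ σ : Equiv.Perm n, ∏ i, M i (σ i)

/-- The characteristic polynomial `φ(M) = det (x·I - M)`. -/
def phi {n R : Type*} [Fintype n] [DecidableEq n] [CommRing R]
    (M : Matrix n n (Polynomial R)) : Polynomial R :=
  ((Polynomial.X : Polynomial R) • (1 : Matrix n n (Polynomial R)) - M).det

/-- The permanental polynomial `ψ(M) = per (x·I - M)`. -/
def psi {n R : Type*} [Fintype n] [DecidableEq n] [CommRing R]
    (M : Matrix n n (Polynomial R)) : Polynomial R :=
  ((Polynomial.X : Polynomial R) • (1 : Matrix n n (Polynomial R)) - M).per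

variable {V : Type*}

/-- The principal submatrix of `M` obtained by deleting the rows and columns indexed by `S`. -/
def delSub {R : Type*} (M : Matrix V V R) (S : Set V) :
    Matrix {w : V // w ∉ S} {w : V // w ∉ S} R :=
  M.submatrix Subtype.val Subtype.val

/-- `C` is a cycle of `G`: a subgraph of `G` that is connected, has nonempty vertex set,
and in which every vertex of `C` has degree exactly `2` in `C`. -/
def IsCycleSub (G : SimpleGraph V) (C : G.Subgraph) : Prop :=
  C.Connected ∧ C.verts.Nonempty ∧ ∀ w ∈ C.verts, (C.neighborSet w).ncard = 2

variable [Fintype V] [DecidableEq V]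

/-- The degree diagonal matrix `D(G)` of a graph. -/
def degMat (R : Type*) [CommRing R] (G : SimpleGraph V) [DecidableRel G.Adj] :
    Matrix V V R :=
  Matrix.diagonal fun w => (G.degree w : R)

/-- The Laplacian matrix `L(G) = D(G) - A(G)`. -/
def lapMat (R : Type*) [CommRing R] (G : SimpleGraph V) [DecidableRel G.Adj] :
    Matrix V V R :=
  degMat R G - G.adjMatrix R

open Equiv in
theorem aux_fiber {V R : Type*} [Fintype V] [DecidableEq V] [CommRing R]
    (M : Matrix V V R) (S : Set V) [Fintype {w : V // w ∉ S}] [DecidableEq {w : V // w ∉ S}] (c : Perm V) (hc : ∀ a, a ∉ S → c a = a)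
    (F : Finset (Perm V)) (hF : ∀ σ, σ ∈ F ↔ ∀ a ∈ S, σ a = c a) :
    ∑ σ ∈ F, ((Perm.sign σ : ℤ) : R) * ∏ i, M (σ i) i
      = ((Perm.sign c : ℤ) : R) * (∏ i with i ∈ S, M (c i) i) * (delSub M S).det := by
  rw [Matrix.det_apply', Finset.mul_sum]
  symm
  refine Finset.sum_bij (fun τ _ => c * Perm.ofSubtype τ) ?_ ?_ ?_ ?_
  · intro τ _
    rw [hF]
    intro a ha
    rw [Perm.mul_apply, Perm.ofSubtype_apply_of_not_mem]
    simpa using ha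
  · intro τ _ τ' _ h
    exact Perm.ofSubtype_injective (mul_left_cancel h)
  · intro σ hσ
    rw [hF] at hσ
    have h1 : ∀ a, (c⁻¹ * σ) a ≠ a → a ∉ S := by
      intro a h ha
      apply h
      rw [Perm.mul_apply, hσ a ha]; simp
    have h2 : ∀ a, a ∉ S ↔ (c⁻¹ * σ) a ∉ S := by
      intro a
      by_cases h : (c⁻¹ * σ) a = a
      · rw [h]
      · exact ⟨fun _ => h1 _ (fun h' => h ((c⁻¹ * σ).injective h')), fun _ => h1 _ h⟩
    refine ⟨(c⁻¹ * σ).subtypePerm (fun a => (h2 a).symm), Finset.mem_univ _, ?_⟩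
    rw [Perm.ofSubtype_subtypePerm _ h1]
    simp
  · intro τ _
    have e : ∏ i, M ((c * Perm.ofSubtype τ) i) i
        = (∏ i with i ∈ S, M (c i) i) * ∏ i, delSub M S (τ i) i := by
      rw [← Finset.prod_filter_mul_prod_filter_not Finset.univ (fun i => i ∈ S)]
      congr 1
      · refine Finset.prod_congr rfl fun i hi => ?_
        simp only [Finset.mem_filter, Finset.mem_univ, true_and] at hi
        rw [Perm.mul_apply, Perm.ofSubtype_apply_of_not_mem]
        simpa using hi
      · rw [Finset.prod_subtype (p := fun i => i ∉ S) _ (by simp)]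
        refine Finset.prod_congr rfl fun i hi => ?_
        rw [Perm.mul_apply, Perm.ofSubtype_apply_coe, hc _ (τ i).2]
        rfl
    have e' : Perm.sign (Perm.ofSubtype τ) = Perm.sign τ := by
      convert Perm.sign_ofSubtype τ
    rw [e, Perm.sign_mul, e']
    push_cast
    ring

theorem aux_det_sub {V R : Type*} [Fintype V] [DecidableEq V] [CommRing R]
    (A : Matrix V V R) (u : V) :
    (A.updateCol u (fun i => A i u - (Pi.single u 1 : V → R) i)).det
      = A.det - (A.updateCol u (Pi.single u 1)).det := by
  have h : (fun i => A i u - (Pi.single u 1 : V → R) i)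
      = (fun i => A i u) + (-1 : R) • (Pi.single u 1 : V → R) := by
    ext i; simp [sub_eq_add_neg]
  rw [h, Matrix.det_updateCol_add, Matrix.det_updateCol_smul, Matrix.updateCol_eq_self]
  ring

open Equiv in
theorem aux_det_single {V R : Type*} [Fintype V] [DecidableEq V] [CommRing R]
    (A : Matrix V V R) (S : Set V) [Fintype {w : V // w ∉ S}] [DecidableEq {w : V // w ∉ S}] (B : Matrix V V R)
    (h1 : ∀ i, ∀ j ∈ S, B i j = if i = j then 1 else 0)
    (h2 : ∀ i, ∀ j, j ∉ S → B i j = A i j) :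
    B.det = (delSub A S).det := by
  have := aux_fiber B S 1 (by simp)
    (Finset.univ.filter fun σ : Perm V => ∀ a ∈ S, σ a = (1 : Perm V) a)
    (fun σ => by simp only [Finset.mem_filter, Finset.mem_univ, true_and])
  have e : (delSub B S) = delSub A S := by
    ext i j
    exact h2 _ _ j.2
  rw [e] at this
  rw [Matrix.det_apply', ← Finset.sum_filter_add_sum_filter_not _ (fun σ : Perm V => ∀ a ∈ S, σ a = (1 : Perm V) a), this]
  rw [Finset.prod_eq_one, Finset.sum_eq_zero]
  · simp
  · intro σ hσ
    simp only [Finset.mem_filter, Finset.mem_univ, true_and, not_forall] at hσ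
    obtain ⟨a, ha, h⟩ := hσ
    rw [Finset.prod_eq_zero (Finset.mem_univ a), mul_zero]
    rw [h1 _ _ ha]; exact if_neg h
  · intro i hi
    simp only [Finset.mem_filter, Finset.mem_univ, true_and] at hi
    rw [h1 _ _ hi]; simp

theorem aux_diag {V R : Type*} [Fintype V] [DecidableEq V] [CommRing R]
    (N M' : Matrix V V R) (u v : V) (huv : u ≠ v)
    (h : ∀ i j, M' i j = N i j - (if i = j ∧ (i = u ∨ i = v) then 1 else 0)) :
    M'.det = N.det - (delSub N {u}).det - (delSub N {v}).det + (delSub N {u, v}).det := by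
  have e1 := aux_det_sub N u
  set N1 := (N.updateCol u (fun i => N i u - (Pi.single u 1 : V → R) i)) with hN1
  have e2 := aux_det_sub N1 v
  have e3 := aux_det_sub (N.updateCol v (Pi.single v 1)) u
  have hM : N1.updateCol v (fun i => N1 i v - (Pi.single v 1 : V → R) i) = M' := by
    ext i j
    rw [h]
    simp only [hN1, Matrix.updateCol_apply, Pi.single_apply]
    clear e1 e2 e3 h hN1
    grind
  have h3 : (N.updateCol v (Pi.single v 1)).updateCol u
      (fun i => (N.updateCol v (Pi.single v 1)) i u - (Pi.single u 1 : V → R) i)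
      = N1.updateCol v (Pi.single v 1) := by
    ext i j
    simp only [hN1, Matrix.updateCol_apply, Pi.single_apply]
    split_ifs <;> simp_all
  rw [h3] at e3
  rw [hM] at e2
  rw [e2, e1, e3]
  rw [aux_det_single N {u} (N.updateCol u (Pi.single u 1)),
    aux_det_single N {v} (N.updateCol v (Pi.single v 1)),
    aux_det_single N {u, v} ((N.updateCol v (Pi.single v 1)).updateCol u (Pi.single u 1))]
  · ring
  all_goals
    intro i j hj
    simp only [Matrix.updateCol_apply, Pi.single_apply, Set.mem_insert_iff, Set.mem_singleton_iff] at *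
    grind
/-- subgraph traced by a permutation -/
def permSub {V : Type*} (G : SimpleGraph V) (c : Equiv.Perm V) : G.Subgraph where
  verts := {a | c a ≠ a}
  Adj a b := G.Adj a b ∧ (c a = b ∨ c b = a)
  adj_sub h := h.1
  edge_vert := by
    rintro a b ⟨h, h1 | h1⟩ h2
    · exact h.ne (h2.symm.trans h1)
    · exact h.ne (c.injective (h2.trans h1.symm))
  symm := ⟨fun a b h => ⟨h.1.symm, h.2.symm⟩⟩

theorem aux_sq {V : Type*} [Fintype V] [DecidableEq V] {c : Equiv.Perm V} (hc : c.IsCycle)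
    {u : V} (hu : c u ≠ u) (h2 : c (c u) ≠ u) {a : V} (ha : c a ≠ a) : c (c a) ≠ a := by
  intro h
  obtain ⟨n, hn⟩ := hc.exists_pow_eq ha hu
  apply h2
  have : c (c ((c ^ n) a)) = (c ^ n) (c (c a)) := by
    simp only [← Equiv.Perm.mul_apply]
    congr 1
    rw [← mul_assoc, ← pow_two, pow_mul_comm]
  rw [← hn, this, h]

theorem aux_mapsTo {V : Type*} [Fintype V] [DecidableEq V] (G : SimpleGraph V)
    {c : Equiv.Perm V} (hc : c.IsCycle)
    {u : V} (hu : c u ≠ u) (h2 : c (c u) ≠ u) (hG : ∀ a, c a ≠ a → G.Adj a (c a)) :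
    IsCycleSub G (permSub G c) := by
  have hsupp : ∀ a, c a ≠ a → c (c a) ≠ c a := fun a ha h => ha (c.injective h)
  have hadj : ∀ a, c a ≠ a → (permSub G c).Adj a (c a) := fun a ha => ⟨hG a ha, Or.inl rfl⟩
  refine ⟨?_, ⟨u, hu⟩, ?_⟩
  · rw [SimpleGraph.Subgraph.connected_iff']
    have : Nonempty (permSub G c).verts := ⟨⟨u, hu⟩⟩
    refine ⟨?_⟩
    have key : ∀ n : ℕ, ∀ a (ha : c a ≠ a), ∃ hb : c ((c ^ n) a) ≠ (c ^ n) a,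
        (permSub G c).coe.Reachable ⟨a, ha⟩ ⟨(c ^ n) a, hb⟩ := by
      intro n a ha
      induction n with
      | zero => exact ⟨by simpa using ha, by simp⟩
      | succ n ih =>
        obtain ⟨hb, hr⟩ := ih
        have e : (c ^ (n + 1)) a = c ((c ^ n) a) := by rw [pow_succ', Equiv.Perm.mul_apply]
        refine ⟨by rw [e]; exact hsupp _ hb, hr.trans ?_⟩
        apply SimpleGraph.Adj.reachable
        rw [SimpleGraph.Subgraph.coe_adj]
        simp only [e]
        exact hadj _ hb
    rintro ⟨a, ha⟩ ⟨b, hb⟩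
    obtain ⟨n, hn⟩ := hc.exists_pow_eq ha hb
    obtain ⟨_, hr⟩ := key n a ha
    simpa only [hn] using hr
  · intro a ha
    have : (permSub G c).neighborSet a = {c a, c.symm a} := by
      ext b
      simp only [SimpleGraph.Subgraph.mem_neighborSet, Set.mem_insert_iff, Set.mem_singleton_iff]
      constructor
      · rintro ⟨_, h | h⟩
        · exact Or.inl h.symm
        · right; rw [← h]; simp
      · rintro (rfl | rfl)
        · exact hadj _ ha
        · have : c (c.symm a) ≠ c.symm a := by
            intro h; apply ha
            have h' := congrArg c h
            simpa using h'
          have h3 := hadj _ this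
          simp only [Equiv.apply_symm_apply] at h3
          exact h3.symm
    rw [this, Set.ncard_pair]
    intro h
    apply aux_sq hc hu h2 ha
    rw [h]; simp

theorem aux_inj {V : Type*} [Fintype V] [DecidableEq V] (G : SimpleGraph V)
    {c d : Equiv.Perm V} (hc : c.IsCycle)
    {u : V} (hu : c u ≠ u) (h2 : c (c u) ≠ u) (hG : ∀ a, c a ≠ a → G.Adj a (c a))
    (hcd : c u = d u) (h : permSub G c = permSub G d) : c = d := by
  have key : ∀ n : ℕ, c ((c ^ n) u) = d ((c ^ n) u) := by
    intro n
    induction n with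
    | zero => simpa using hcd
    | succ n ih =>
      have e : (c ^ (n + 1)) u = c ((c ^ n) u) := by rw [pow_succ', Equiv.Perm.mul_apply]
      rw [e]
      set w := (c ^ n) u with hw
      have hwu : c w ≠ w := by
        rw [hw, ← Equiv.Perm.mul_apply, ← pow_succ', pow_succ, Equiv.Perm.mul_apply]
        exact fun h => hu ((c ^ n).injective h)
      have h1 : (permSub G c).Adj (c w) (c (c w)) :=
        ⟨hG _ (fun h => hwu (c.injective h)), Or.inl rfl⟩
      rw [h] at h1
      rcases h1.2 with h1 | h1
      · exact h1.symm
      · rw [ih] at h1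
        exact absurd (by rw [ih]; exact d.injective h1) (aux_sq hc hu h2 hwu)
  ext a
  by_cases ha : c a = a
  · have : a ∉ (permSub G c).verts := fun h => h ha
    rw [h] at this
    have : d a = a := not_not.mp this
    rw [ha, this]
  · obtain ⟨n, rfl⟩ := hc.exists_pow_eq hu ha
    exact key n

theorem aux_exists_perm {V : Type*} [Fintype V] [DecidableEq V] (G : SimpleGraph V)
    (C : G.Subgraph) (hC : IsCycleSub G C) (u : V) (hu : u ∈ C.verts) :
    ∃ c : Equiv.Perm V, c.IsCycle ∧ (∀ a, c a ≠ a ↔ a ∈ C.verts) ∧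
      ∀ a ∈ C.verts, C.Adj a (c a) := by
  obtain ⟨hconn, -, hdeg⟩ := hC
  have hcyc : C.spanningCoe.IsCycles := by
    rintro a ⟨b, hb⟩
    exact hdeg a (C.edge_vert hb)
  have hne : (C.spanningCoe.neighborSet u).Nonempty := by
    have := hdeg u hu
    have h : (C.neighborSet u).Nonempty := by
      by_contra h
      rw [Set.not_nonempty_iff_eq_empty] at h
      rw [h] at this; simp at this
    exact h
  obtain ⟨p, hp, hv⟩ := hcyc.exists_cycle_toSubgraph_verts_eq_connectedComponentSupp
    (c := C.spanningCoe.connectedComponentMk u) rfl hne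
  have hverts : ∀ w, w ∈ p.support ↔ w ∈ C.verts := by
    intro w
    rw [← SimpleGraph.Walk.mem_verts_toSubgraph, hv, SimpleGraph.ConnectedComponent.mem_supp_iff,
      SimpleGraph.ConnectedComponent.eq]
    constructor
    · rintro ⟨q⟩
      cases q with
      | nil => exact hu
      | cons h q => exact C.edge_vert h
    · intro hw
      have := hconn.preconnected.coe ⟨w, hw⟩ ⟨u, hu⟩
      exact this.map ⟨Subtype.val, fun h => h⟩
  set l := p.support.tail with hl
  have hnd : l.Nodup := hp.support_nodup
  have hlen : l.length = p.length := by simp [hl]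
  have h3 := hp.three_le_length
  have hmem : ∀ w, w ∈ l ↔ w ∈ C.verts := by
    intro w
    rw [← hverts]
    constructor
    · exact List.mem_of_mem_tail
    · intro h
      rcases (SimpleGraph.Walk.mem_support_iff p).1 h with rfl | h
      · exact SimpleGraph.Walk.end_mem_tail_support hp.not_nil
      · exact h
  have hget : ∀ i (hi : i < l.length), l[i] = p.getVert (i + 1) := by
    intro i hi
    rw [SimpleGraph.Walk.getVert_eq_support_getElem _ (by omega)]
    simp [hl]
  refine ⟨l.formPerm, List.isCycle_formPerm hnd (by omega), ?_, ?_⟩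
  · intro a
    rw [← hmem]
    constructor
    · exact List.mem_of_formPerm_apply_ne
    · intro h
      exact (List.formPerm_apply_mem_ne_self_iff _ hnd _ h).2 (by omega)
  · intro a ha
    rw [← hmem] at ha
    obtain ⟨i, hi, rfl⟩ := List.getElem_of_mem ha
    rw [List.formPerm_apply_getElem _ hnd, hget, hget]
    by_cases h : i + 1 < l.length
    · rw [Nat.mod_eq_of_lt h]
      exact p.adj_getVert_succ (by omega)
    · have e : i + 1 = l.length := by omega
      rw [e, Nat.mod_self, hlen, SimpleGraph.Walk.getVert_length]
      have := p.adj_getVert_succ (i := 0) (by omega)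
      rwa [SimpleGraph.Walk.getVert_zero] at this

theorem aux_surj {V : Type*} [Fintype V] [DecidableEq V] (G : SimpleGraph V)
    (C : G.Subgraph) (hC : IsCycleSub G C) (u v : V) (huv : C.Adj u v) :
    ∃ c : Equiv.Perm V, c.IsCycle ∧ c u = v ∧ c v ≠ u ∧ (∀ a, c a ≠ a → G.Adj a (c a)) ∧
      permSub G c = C := by
  have main : ∀ c : Equiv.Perm V, c.IsCycle → (∀ a, c a ≠ a ↔ a ∈ C.verts) →
      (∀ a ∈ C.verts, C.Adj a (c a)) → 
      (∀ a ∈ C.verts, c (c a) ≠ a) ∧ permSub G c = C := by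
    intro c hc hv ha
    have hsq : ∀ a ∈ C.verts, c (c a) ≠ a := by
      intro a haC h
      have h1 := hC.2.2 a haC
      have hsub : C.neighborSet a ⊆ {c a} := by
        intro b hb
        have hbC : b ∈ C.verts := C.edge_vert hb.symm
        obtain ⟨n, hn⟩ := hc.exists_pow_eq ((hv a).2 haC) ((hv b).2 hbC)
        have key : ∀ n : ℕ, (c ^ n) a = a ∨ (c ^ n) a = c a := by
          intro n
          induction n with
          | zero => simp
          | succ n ih =>
            rw [pow_succ', Equiv.Perm.mul_apply]
            rcases ih with ih | ih <;> rw [ih]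
            · exact Or.inr rfl
            · exact Or.inl h
        rcases key n with h' | h'
        · rw [hn] at h'
          exact absurd h'.symm (C.adj_sub hb).ne
        · rw [hn] at h'
          exact h'
      have := Set.ncard_le_ncard hsub
      rw [h1, Set.ncard_singleton] at this
      omega
    refine ⟨hsq, ?_⟩
    ext a b
    · exact hv a
    · constructor
      · rintro ⟨hab, h | h⟩
        · subst h
          exact ha a ((hv a).1 hab.ne.symm)
        · subst h
          exact (ha b ((hv b).1 hab.ne)).symm
      · intro hab
        refine ⟨hab.adj_sub, ?_⟩
        have haC := C.edge_vert hab
        have hs : c.symm a ∈ C.verts := by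
          rw [← hv]; simp only [Equiv.apply_symm_apply]
          intro h
          apply (hv a).2 haC
          have h' := congrArg c h
          simpa using h'
        have hs' := ha _ hs
        rw [Equiv.apply_symm_apply] at hs'
        have hsub : ({c a, c.symm a} : Set V) ⊆ C.neighborSet a := by
          rintro x (rfl | rfl)
          · exact ha a haC
          · exact hs'.symm
        have heq := Set.eq_of_subset_of_ncard_le hsub (by
          rw [hC.2.2 a haC, Set.ncard_pair]
          intro h
          apply hsq a haC
          rw [h]; simp)
        have hb : b ∈ C.neighborSet a := hab
        rw [← heq] at hb
        rcases hb with rfl | rfl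
        · exact Or.inl rfl
        · right; simp
  obtain ⟨c, hc, hv, ha⟩ := aux_exists_perm G C hC u (C.edge_vert huv)
  obtain ⟨hsq, hE⟩ := main c hc hv ha
  have huv' := huv
  rw [← hE] at huv'
  rcases huv'.2 with h | h
  · refine ⟨c, hc, h, ?_, fun a h' => (ha a ((hv a).1 h')).adj_sub, hE⟩
    rw [← h]
    exact hsq u (C.edge_vert huv)
  · have hv' : ∀ a, c⁻¹ a ≠ a ↔ a ∈ C.verts := by
      intro a
      rw [← hv, not_iff_not, Equiv.Perm.inv_eq_iff_eq]
      exact eq_comm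
    have ha' : ∀ a ∈ C.verts, C.Adj a (c⁻¹ a) := by
      intro a haC
      have hs : c⁻¹ a ∈ C.verts := by
        rw [← hv']
        intro h'
        exact (hv' a).2 haC (c⁻¹.injective h')
      have := ha _ hs
      rw [show c (c⁻¹ a) = a by simp] at this
      exact this.symm
    obtain ⟨hsq', hE'⟩ := main c⁻¹ hc.inv hv' ha'
    have h' : c⁻¹ u = v := by rw [← h]; simp
    refine ⟨c⁻¹, hc.inv, h', ?_, fun a h' => (ha' a ((hv' a).1 h')).adj_sub, hE'⟩
    rw [← h']
    exact hsq' u (C.edge_vert huv)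
open Equiv in
theorem aux_sum_cycles {V R : Type*} [Fintype V] [DecidableEq V] [CommRing R]
    (t : Perm V → R) (u v : V) (huv : u ≠ v) :
    ∑ σ : Perm V with (σ u = v ∧ σ v ≠ u), t σ
      = ∑ c : Perm V with (c.IsCycle ∧ c u = v ∧ c v ≠ u),
        ∑ σ : Perm V with (∀ a ∈ {a | c a ≠ a}, σ a = c a), t σ := by
  rw [← Finset.sum_fiberwise_of_maps_to (g := fun σ : Perm V => σ.cycleOf u)
    (t := Finset.univ.filter (fun c : Perm V => c.IsCycle ∧ c u = v ∧ c v ≠ u))]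
  · refine Finset.sum_congr rfl fun c hc => ?_
    simp only [Finset.mem_filter, Finset.mem_univ, true_and] at hc
    obtain ⟨hc, hcu, hcv⟩ := hc
    rw [Finset.filter_filter]
    refine Finset.sum_congr (Finset.filter_congr fun σ _ => ?_) fun _ _ => rfl
    constructor
    · rintro ⟨-, rfl⟩ a ha
      have : σ.SameCycle u a := by
        by_contra h
        exact ha (Perm.cycleOf_apply_of_not_sameCycle h)
      exact (this.cycleOf_apply).symm
    · intro h
      have hu : c u ≠ u := by rw [hcu]; exact huv.symm
      have hv : c v ≠ v := by rw [← hcu]; exact fun h => hu (c.injective h)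
      refine ⟨⟨by rw [h u hu, hcu], by rw [h v hv]; exact hcv⟩, ?_⟩
      symm
      apply Perm.cycle_is_cycleOf (Perm.mem_support.2 hu)
      rw [Perm.mem_cycleFactorsFinset_iff]
      exact ⟨hc, fun a ha => (h a (Perm.mem_support.1 ha)).symm⟩
  · intro σ hσ
    simp only [Finset.mem_filter, Finset.mem_univ, true_and] at hσ ⊢
    obtain ⟨h1, h2⟩ := hσ
    have hu : σ u ≠ u := by rw [h1]; exact huv.symm
    refine ⟨Perm.isCycle_cycleOf σ hu, by simpa using h1, ?_⟩
    have : σ.SameCycle u v := ⟨1, by simpa using h1⟩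
    rw [this.cycleOf_apply]
    exact h2

open Equiv in
theorem aux_inv {V R : Type*} [Fintype V] [DecidableEq V] [CommRing R]
    (M : Matrix V V R) (hM : ∀ i j, M i j = M j i) (u v : V) :
    ∑ σ : Perm V with (σ v = u ∧ σ u ≠ v), ((Perm.sign σ : ℤ) : R) * ∏ i, M (σ i) i
    = ∑ σ : Perm V with (σ u = v ∧ σ v ≠ u), ((Perm.sign σ : ℤ) : R) * ∏ i, M (σ i) i := by
  refine Finset.sum_bij' (fun σ _ => σ⁻¹) (fun σ _ => σ⁻¹) ?_ ?_ ?_ ?_ ?_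
  · intro σ hσ
    simp only [Finset.mem_filter, Finset.mem_univ, true_and, ne_eq, Perm.inv_eq_iff_eq] at hσ ⊢
    exact ⟨hσ.1.symm, fun h => hσ.2 h.symm⟩
  · intro σ hσ
    simp only [Finset.mem_filter, Finset.mem_univ, true_and, ne_eq, Perm.inv_eq_iff_eq] at hσ ⊢
    exact ⟨hσ.1.symm, fun h => hσ.2 h.symm⟩
  · simp
  · simp
  · intro σ _
    rw [Perm.sign_inv]
    congr 1
    rw [← Equiv.prod_comp σ (fun i => M (σ⁻¹ i) i)]
    refine Finset.prod_congr rfl fun i _ => ?_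
    rw [hM]; simp

open Equiv in
/-- the determinant expansion around an edge -/
theorem aux_main {V R : Type*} [Fintype V] [DecidableEq V] [CommRing R]
    (G : SimpleGraph V) [DecidableRel G.Adj] (M N : Matrix V V R) (u v : V) (huv : G.Adj u v)
    (hM : ∀ i j, i ≠ j → M i j = if G.Adj i j then 1 else 0)
    (hN : ∀ i j, N i j = if (i = u ∧ j = v) ∨ (i = v ∧ j = u) then 0 else
      M i j + (if i = j ∧ (i = u ∨ i = v) then 1 else 0)) :
    M.det = N.det - (delSub N {u}).det - (delSub N {v}).det
      - 2 * ∑ c : Perm V with (c.IsCycle ∧ c u = v ∧ c v ≠ u ∧ ∀ a, c a ≠ a → G.Adj a (c a)),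
        (-1) ^ (permSub G c).verts.ncard * (delSub M (permSub G c).verts).det := by
  have hne := huv.ne
  have hsymm : ∀ i j, M i j = M j i := by
    intro i j
    by_cases h : i = j
    · rw [h]
    · rw [hM i j h, hM j i (Ne.symm h)]
      simp only [G.adj_comm i j]
  let M' : Matrix V V R := fun i j => if (i = u ∧ j = v) ∨ (i = v ∧ j = u) then 0 else M i j
  have hd := aux_diag N M' u v hne (by
    intro i j
    simp only [M', hN]
    grind)
  have hNM : delSub N {u, v} = delSub M {u, v} := by
    ext ⟨i, hi⟩ ⟨j, hj⟩
    simp only [Set.mem_insert_iff, Set.mem_singleton_iff] at hi hj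
    simp only [delSub, Matrix.submatrix_apply, hN]
    grind
  have hsw : ∑ σ : Perm V with (σ u = v ∧ σ v = u), ((Perm.sign σ : ℤ) : R) * ∏ i, M (σ i) i
      = - (delSub M {u, v}).det := by
    have := aux_fiber M {u, v} (swap u v) (by
      intro a ha
      simp only [Set.mem_insert_iff, Set.mem_singleton_iff, not_or] at ha
      exact swap_apply_of_ne_of_ne ha.1 ha.2)
      (Finset.univ.filter fun σ : Perm V => σ u = v ∧ σ v = u) (by simp)
    rw [Finset.prod_eq_one, Perm.sign_swap hne] at this
    · rw [this]
      simp
    · intro i hi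
      simp only [Finset.mem_filter, Finset.mem_univ, true_and, Set.mem_insert_iff,
        Set.mem_singleton_iff] at hi
      rcases hi with rfl | rfl
      · rw [swap_apply_left, hM _ _ hne.symm, if_pos huv.symm]
      · rw [swap_apply_right, hM _ _ hne, if_pos huv]
  have hcyc : ∑ σ : Perm V with (σ u = v ∧ σ v ≠ u), ((Perm.sign σ : ℤ) : R) * ∏ i, M (σ i) i
      = - ∑ c : Perm V with (c.IsCycle ∧ c u = v ∧ c v ≠ u ∧ ∀ a, c a ≠ a → G.Adj a (c a)),
        (-1) ^ (permSub G c).verts.ncard * (delSub M (permSub G c).verts).det := by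
    rw [aux_sum_cycles _ u v hne, ← Finset.sum_neg_distrib]
    symm
    refine Finset.sum_subset_zero_on_sdiff ?_ ?_ ?_
    · intro c hc
      simp only [Finset.mem_filter, Finset.mem_univ, true_and] at hc ⊢
      exact ⟨hc.1, hc.2.1, hc.2.2.1⟩
    · intro c hc
      simp only [Finset.mem_sdiff, Finset.mem_filter, Finset.mem_univ, true_and] at hc
      obtain ⟨⟨h1, h2, h3⟩, h4⟩ := hc
      have h5 : ¬ ∀ a, c a ≠ a → G.Adj a (c a) := fun h => h4 ⟨h1, h2, h3, h⟩
      push Not at h5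
      obtain ⟨a, ha, hna⟩ := h5
      rw [aux_fiber M {a | c a ≠ a} c (by simp) _ (by simp), Finset.prod_eq_zero (i := a)]
      · ring
      · simpa using ha
      · rw [hM _ _ ha, if_neg (fun h => hna h.symm)]
    · intro c hc
      simp only [Finset.mem_filter, Finset.mem_univ, true_and] at hc
      obtain ⟨h1, h2, h3, h4⟩ := hc
      have := aux_fiber M (permSub G c).verts c (by
        intro a ha
        exact not_not.1 ha)
        (Finset.univ.filter fun σ : Perm V => ∀ a ∈ {a | c a ≠ a}, σ a = c a) (by simp [permSub])
      refine Eq.trans ?_ this.symm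
      rw [Finset.prod_eq_one, h1.sign]
      · have hcard : (permSub G c).verts.ncard = c.support.card := by
          rw [← Set.ncard_coe_finset]
          congr 1
          ext a
          simp [permSub]
        rw [hcard]
        push_cast
        ring
      · intro a ha
        simp only [Finset.mem_filter, Finset.mem_univ, true_and] at ha
        rw [hM _ _ ha, if_pos (h4 a ha).symm]
  have hcyc' := aux_inv M hsymm u v
  have hsplit : M.det = M'.det
      + ∑ σ : Perm V with (σ u = v ∧ σ v = u), ((Perm.sign σ : ℤ) : R) * ∏ i, M (σ i) i
      + ∑ σ : Perm V with (σ u = v ∧ σ v ≠ u), ((Perm.sign σ : ℤ) : R) * ∏ i, M (σ i) i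
      + ∑ σ : Perm V with (σ v = u ∧ σ u ≠ v), ((Perm.sign σ : ℤ) : R) * ∏ i, M (σ i) i := by
    rw [Matrix.det_apply', Matrix.det_apply', Finset.sum_filter, Finset.sum_filter,
      Finset.sum_filter, ← Finset.sum_add_distrib, ← Finset.sum_add_distrib,
      ← Finset.sum_add_distrib]
    refine Finset.sum_congr rfl fun σ _ => ?_
    by_cases h : σ u = v ∨ σ v = u
    · have h0 : ∏ i, M' (σ i) i = 0 := by
        rcases h with h | h
        · exact Finset.prod_eq_zero (Finset.mem_univ u) (by simp [M', h])
        · exact Finset.prod_eq_zero (Finset.mem_univ v) (by simp [M', h])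
      rw [h0]
      by_cases h1 : σ u = v <;> by_cases h2 : σ v = u <;> simp_all
    · push Not at h
      have h0 : ∏ i, M' (σ i) i = ∏ i, M (σ i) i := by
        refine Finset.prod_congr rfl fun i _ => if_neg ?_
        rintro (⟨h1, rfl⟩ | ⟨h1, rfl⟩)
        · exact h.2 h1
        · exact h.1 h1
      rw [h0]
      simp [h.1, h.2]
  rw [hsplit, hcyc', hcyc, hsw, hd, hNM]
  ring
theorem laplacian_charpoly_edge_recursion
    {V : Type*} [Fintype V] [DecidableEq V]
    (G : SimpleGraph V) [DecidableRel G.Adj] (u v : V) (he : G.Adj u v) :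
    phi (lapMat (Polynomial ℤ) G) =
      phi (lapMat (Polynomial ℤ) (G.deleteEdges {s(u, v)}))
        - phi (delSub (lapMat (Polynomial ℤ) (G.deleteEdges {s(u, v)})) {u})
        - phi (delSub (lapMat (Polynomial ℤ) (G.deleteEdges {s(u, v)})) {v})
        - 2 * ∑ᶠ C ∈ {C : G.Subgraph | IsCycleSub G C ∧ C.Adj u v},
          (-1 : Polynomial ℤ) ^ C.verts.ncard * phi (delSub (lapMat (Polynomial ℤ) G) C.verts) := by
  set G' := G.deleteEdges {s(u, v)} with hG'
  have hne := he.ne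
  set M : Matrix V V ℤ[X] := (X : ℤ[X]) • (1 : Matrix V V ℤ[X]) - lapMat ℤ[X] G with hM
  set N : Matrix V V ℤ[X] := (X : ℤ[X]) • (1 : Matrix V V ℤ[X]) - lapMat ℤ[X] G' with hN
  have hdel : ∀ (A : Matrix V V ℤ[X]) (S : Set V),
      (X : ℤ[X]) • (1 : Matrix {w : V // w ∉ S} {w : V // w ∉ S} ℤ[X]) - delSub A S
        = delSub ((X : ℤ[X]) • (1 : Matrix V V ℤ[X]) - A) S := by
    intro A S
    ext i j : 2
    simp [delSub, Matrix.one_apply, Subtype.ext_iff]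
  have hadj' : ∀ a b, G'.Adj a b ↔ G.Adj a b ∧ ¬ ((a = u ∧ b = v) ∨ (a = v ∧ b = u)) := by
    intro a b
    simp [hG', SimpleGraph.deleteEdges_adj]
  have hdeg : ∀ w, (G.degree w : ℤ[X]) = G'.degree w + (if w = u ∨ w = v then 1 else 0) := by
    intro w
    have key : ∀ x y : V, G.Adj x y → ((x = u ∧ y = v) ∨ (x = v ∧ y = u)) →
        G.degree x = G'.degree x + 1 := by
      intro x y hxy h
      rw [← SimpleGraph.card_neighborFinset_eq_degree, ← SimpleGraph.card_neighborFinset_eq_degree]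
      have : G.neighborFinset x = insert y (G'.neighborFinset x) := by
        ext z
        simp only [SimpleGraph.mem_neighborFinset, Finset.mem_insert, hadj']
        grind
      rw [this, Finset.card_insert_of_notMem]
      simp only [SimpleGraph.mem_neighborFinset, hadj']
      tauto
    split_ifs with h
    · rcases h with rfl | rfl
      · rw [key w v he (Or.inl ⟨rfl, rfl⟩)]; push_cast; rfl
      · rw [key w u he.symm (Or.inr ⟨rfl, rfl⟩)]; push_cast; rfl
    · rw [add_zero]
      congr 1
      rw [← SimpleGraph.card_neighborFinset_eq_degree, ← SimpleGraph.card_neighborFinset_eq_degree]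
      congr 1
      ext z
      simp only [SimpleGraph.mem_neighborFinset, hadj']
      tauto
  have h1 : ∀ i j, i ≠ j → M i j = if G.Adj i j then 1 else 0 := by
    intro i j hij
    simp [hM, lapMat, degMat, hij, SimpleGraph.adjMatrix_apply]
  have h2 : ∀ i j, N i j = if (i = u ∧ j = v) ∨ (i = v ∧ j = u) then 0 else
      M i j + (if i = j ∧ (i = u ∨ i = v) then 1 else 0) := by
    intro i j
    by_cases hij : i = j
    · subst hij
      have : ¬ ((i = u ∧ i = v) ∨ (i = v ∧ i = u)) := by grind
      rw [if_neg this]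
      simp only [hM, hN, lapMat, degMat, Matrix.sub_apply, Matrix.smul_apply,
        Matrix.one_apply_eq, Matrix.diagonal_apply_eq, SimpleGraph.adjMatrix_apply,
        SimpleGraph.irrefl, if_false, hdeg, true_and]
      ring
    · have e : N i j = if G'.Adj i j then 1 else 0 := by
        simp [hN, lapMat, degMat, hij, SimpleGraph.adjMatrix_apply]
      rw [e, h1 i j hij]
      simp only [hadj', hij, false_and, if_false, add_zero]
      grind
  have main := aux_main G M N u v he h1 h2
  have hsum : ∑ᶠ C ∈ {C : G.Subgraph | IsCycleSub G C ∧ C.Adj u v},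
          (-1 : Polynomial ℤ) ^ C.verts.ncard * phi (delSub (lapMat (Polynomial ℤ) G) C.verts)
      = ∑ c : Equiv.Perm V with
          (c.IsCycle ∧ c u = v ∧ c v ≠ u ∧ ∀ a, c a ≠ a → G.Adj a (c a)),
        (-1) ^ (permSub G c).verts.ncard * (delSub M (permSub G c).verts).det := by
    rw [← finsum_mem_finset_eq_sum]
    symm
    refine finsum_mem_eq_of_bijOn (permSub G) ⟨?_, ?_, ?_⟩ ?_
    · intro c hc
      simp only [Finset.coe_filter, Finset.mem_univ, true_and, Set.mem_ofPred_eq] at hc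
      obtain ⟨a1, a2, a3, a4⟩ := hc
      have hu : c u ≠ u := by rw [a2]; exact hne.symm
      exact ⟨aux_mapsTo G a1 hu (by rw [a2]; exact a3) a4, he, Or.inl a2⟩
    · intro c hc d hd h
      simp only [Finset.coe_filter, Finset.mem_univ, true_and, Set.mem_ofPred_eq] at hc hd
      obtain ⟨a1, a2, a3, a4⟩ := hc
      have hu : c u ≠ u := by rw [a2]; exact hne.symm
      exact aux_inj G a1 hu (by rw [a2]; exact a3) a4 (by rw [a2, hd.2.1]) h
    · rintro C ⟨hC, hCuv⟩
      obtain ⟨c, b1, b2, b3, b4, b5⟩ := aux_surj G C hC u v hCuv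
      exact ⟨c, by simpa using ⟨b1, b2, b3, b4⟩, b5⟩
    · intro c _
      rw [phi, hdel]
  rw [hsum]
  simp only [phi, hdel]
  exact main
end
end

section
/- Let G be a simple graph on a finite vertex type and let v be a vertex of G. Then the characteristic polynomial of the signless Laplacian matrix satisfies φ(Q(G)) = (x − d(v))·φ(Q_v(G)) − Σ_{u ∈ N(v)} φ(Q_{uv}(G)) − 2·Σ_{C ∈ 𝔠_G(v)} φ(Q_{V(C)}(G)). -/
open Polynomial Matrix

attribute [local instance] Classical.propDecidable

noncomputable section

variable {V : Type*}

variable [Fintype V] [DecidableEq V]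

/-- The signless Laplacian matrix `Q(G) = D(G) + A(G)`. -/
def qMat (R : Type*) [CommRing R] (G : SimpleGraph V) [DecidableRel G.Adj] :
    Matrix V V R :=
  degMat R G + G.adjMatrix R


lemma det_delSub_congr {V R : Type*} [CommRing R] (M : Matrix V V R) {S T : Set V}
    [Fintype {w : V // w ∉ S}] [Fintype {w : V // w ∉ T}]
    [DecidableEq {w : V // w ∉ S}] [DecidableEq {w : V // w ∉ T}] (h : S = T) :
    (delSub M S).det = (delSub M T).det := by
  subst h
  congr!

open Equiv Equiv.Perm in
lemma det_fiber {V R : Type*} [Fintype V] [DecidableEq V] [CommRing R]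
    (M : Matrix V V R) (v : V) (c : Perm V) (hc : c.cycleOf v = c) :
    ∑ σ : Perm V with σ.cycleOf v = c, ((sign σ : ℤ) : R) * ∏ i, M (σ i) i =
      ((sign c : ℤ) : R) * (∏ i ∈ insert v c.support, M (c i) i) *
        (delSub M (↑(insert v c.support) : Set V)).det := by
  set S : Finset V := insert v c.support with hS
  have hcS : ∀ w, w ∉ S → c w = w := by
    intro w hw
    simp only [hS, Finset.mem_insert, not_or, mem_support, not_not] at hw
    exact hw.2
  rw [det_apply', Finset.mul_sum]
  symm
  have hfix : ∀ (τ : Perm {w : V // w ∉ (S : Set V)}) (w : V), w ∈ S → ofSubtype τ w = w := by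
    intro τ w hw
    exact ofSubtype_apply_of_not_mem τ (by simpa using hw)
  have hdis : ∀ (τ : Perm {w : V // w ∉ (S : Set V)}), Perm.Disjoint c (ofSubtype τ) := by
    intro τ w
    by_cases hw : w ∈ S
    · right; exact hfix τ w hw
    · left; exact hcS w hw
  refine Finset.sum_bij (fun τ _ => c * ofSubtype τ) ?_ ?_ ?_ ?_
  · intro τ _
    simp only [Finset.mem_filter, Finset.mem_univ, true_and]
    rw [cycleOf_mul_of_apply_right_eq_self (hdis τ).commute v (hfix τ v (by simp [hS])), hc]
  · intro τ _ τ' _ h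
    exact ofSubtype_injective (mul_left_cancel h)
  · intro σ hσ
    simp only [Finset.mem_filter, Finset.mem_univ, true_and] at hσ
    have key : ∀ w ∈ S, (c⁻¹ * σ) w = w := by
      intro w hw
      have hsc : SameCycle σ v w := by
        simp only [hS, Finset.mem_insert] at hw
        rcases hw with rfl | hw
        · exact SameCycle.refl _ _
        · rw [← hσ] at hw
          by_contra hn
          rw [mem_support, cycleOf_apply, if_neg hn] at hw
          exact hw rfl
      have : c w = σ w := by rw [← hσ]; exact hsc.cycleOf_apply
      simp [← this]
    have h1 : ∀ x, (c⁻¹ * σ) x ∉ (S : Set V) ↔ x ∉ (S : Set V) := by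
      intro x
      simp only [Finset.mem_coe, not_iff_not]
      constructor
      · intro hx
        have := key _ hx
        have := (c⁻¹ * σ).injective this
        rwa [this] at hx
      · intro hx
        rw [key x hx]; exact hx
    refine ⟨(c⁻¹ * σ).subtypePerm h1, Finset.mem_univ _, ?_⟩
    rw [ofSubtype_subtypePerm]
    · simp
    · intro x hx
      by_contra hn
      exact hx (key x (by simpa using hn))
  · intro τ _
    have e1 : ∏ i, M ((c * ofSubtype τ) i) i =
        (∏ i ∈ S, M (c i) i) * ∏ i : {w : V // w ∉ (S : Set V)}, delSub M (S : Set V) (τ i) i := by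
      rw [← Finset.prod_mul_prod_compl S]
      congr 1
      · refine Finset.prod_congr rfl fun i hi => ?_
        rw [Perm.mul_apply, hfix τ i hi]
      · rw [Finset.prod_subtype Sᶜ (p := fun w => w ∉ (S : Set V)) (by simp)]
        refine Finset.prod_congr rfl fun i _ => ?_
        rw [Perm.mul_apply, ofSubtype_apply_coe, hcS _ (by simpa using (τ i).2)]
        rfl
    rw [e1, Perm.sign_mul, sign_ofSubtype]
    push_cast
    ring

open Equiv Equiv.Perm in
lemma det_expand {V R : Type*} [Fintype V] [DecidableEq V] [CommRing R]
    (M : Matrix V V R) (v : V) :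
    M.det = M v v * (delSub M {v}).det +
      ∑ c : Perm V with c.IsCycle ∧ c v ≠ v,
        ((sign c : ℤ) : R) * (∏ i ∈ c.support, M (c i) i) *
        (delSub M (↑c.support : Set V)).det := by
  have h0 : M.det = ∑ c : Perm V with c.cycleOf v = c,
      ∑ σ : Perm V with σ.cycleOf v = c, ((sign σ : ℤ) : R) * ∏ i, M (σ i) i := by
    rw [det_apply']
    refine (Finset.sum_fiberwise_of_maps_to (g := fun σ : Perm V => σ.cycleOf v) ?_ _).symm
    intro σ _
    simp only [Finset.mem_filter, Finset.mem_univ, true_and]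
    by_cases h : σ v = v
    · rw [(cycleOf_eq_one_iff σ).2 h, cycleOf_one]
    · exact (isCycle_cycleOf σ h).cycleOf_eq (by rwa [cycleOf_apply_self])
  have hset : (Finset.univ.filter fun c : Perm V => c.cycleOf v = c) =
      insert 1 (Finset.univ.filter fun c : Perm V => c.IsCycle ∧ c v ≠ v) := by
    ext c
    simp only [Finset.mem_filter, Finset.mem_univ, true_and, Finset.mem_insert]
    constructor
    · intro h
      by_cases hv : c v = v
      · left; rw [← h]; exact (cycleOf_eq_one_iff c).2 hv
      · right; refine ⟨?_, hv⟩; rw [← h]; exact isCycle_cycleOf c hv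
    · rintro (rfl | ⟨h1, h2⟩)
      · exact cycleOf_one v
      · exact h1.cycleOf_eq h2
  rw [h0, hset, Finset.sum_insert (by simp [not_isCycle_one])]
  congr 1
  · rw [det_fiber M v 1 (cycleOf_one v)]
    simp
    rw [det_delSub_congr M (T := {v}) (by simp)]
  · refine Finset.sum_congr rfl fun c hc => ?_
    simp only [Finset.mem_filter, Finset.mem_univ, true_and] at hc
    rw [det_fiber M v c (hc.1.cycleOf_eq hc.2), Finset.insert_eq_of_mem (by simpa using hc.2)]

/-- The subgraph of `G` traced by a permutation. -/
def cycSub {V : Type*} (G : SimpleGraph V) (c : Equiv.Perm V) : G.Subgraph where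
  verts := {w | c w ≠ w}
  Adj a b := G.Adj a b ∧ (c a = b ∨ c b = a)
  adj_sub h := h.1
  edge_vert := by
    rintro a b ⟨h1, h2⟩ h3
    have := h1.ne
    rcases h2 with h2 | h2
    · exact this (h3.symm.trans h2)
    · exact this (c.injective (h3.trans h2.symm))
  symm := ⟨fun a b h => ⟨h.1.symm, h.2.symm⟩⟩

/-- Permutations tracing a cycle of length at least three through `v`. -/
def GoodPerm {V : Type*} (G : SimpleGraph V) (v : V) (c : Equiv.Perm V) : Prop :=
  (c.IsCycle ∧ c v ≠ v) ∧ (∀ i, c i ≠ i → G.Adj i (c i)) ∧ c (c v) ≠ v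

section
open Equiv Equiv.Perm
variable {V : Type*} [Fintype V] [DecidableEq V] {G : SimpleGraph V} {v : V} {c c' : Perm V}

lemma GoodPerm.sq_ne (h : GoodPerm G v c) {w : V} (hw : c w ≠ w) : c (c w) ≠ w := by
  intro hn
  have : c ^ 2 = 1 := (h.1.1.pow_eq_one_iff' hw).2 (by simpa [pow_two] using hn)
  apply h.2.2
  have := congrArg (fun f : Perm V => f v) this
  simpa [pow_two] using this

lemma GoodPerm.adj_iff (h : GoodPerm G v c) {w u : V} (hw : c w ≠ w) :
    (cycSub G c).Adj w u ↔ u = c w ∨ u = c⁻¹ w := by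
  constructor
  · rintro ⟨_, h2 | h2⟩
    · exact Or.inl h2.symm
    · right; rw [← h2]; simp
  · rintro (rfl | rfl)
    · exact ⟨h.2.1 w hw, Or.inl rfl⟩
    · refine ⟨?_, Or.inr (by simp)⟩
      have := h.2.1 (c⁻¹ w) (by
        intro h'
        apply hw
        have h2 : w = c⁻¹ w := by simpa using h'
        rw [Perm.eq_inv_iff_eq] at h2
        exact h2)
      simpa using this.symm

lemma GoodPerm.ne_inv (h : GoodPerm G v c) {w : V} (hw : c w ≠ w) : c w ≠ c⁻¹ w := by
  intro h'
  rw [Perm.eq_inv_iff_eq] at h'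
  exact h.sq_ne hw h'

lemma GoodPerm.ncard (h : GoodPerm G v c) {w : V} (hw : c w ≠ w) :
    ((cycSub G c).neighborSet w).ncard = 2 := by
  have : (cycSub G c).neighborSet w = {c w, c⁻¹ w} := by
    ext u
    simp [SimpleGraph.Subgraph.mem_neighborSet, h.adj_iff hw]
  rw [this, Set.ncard_pair (h.ne_inv hw)]

lemma GoodPerm.isCycleSub (h : GoodPerm G v c) : IsCycleSub G (cycSub G c) := by
  have hv : v ∈ (cycSub G c).verts := h.1.2
  refine ⟨?_, ⟨v, hv⟩, fun w hw => h.ncard hw⟩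
  rw [SimpleGraph.Subgraph.connected_iff']
  have key : ∀ n : ℕ, ∃ hn : (c ^ n) v ∈ (cycSub G c).verts,
      (cycSub G c).coe.Reachable ⟨v, hv⟩ ⟨(c ^ n) v, hn⟩ := by
    intro n
    induction n with
    | zero => exact ⟨hv, SimpleGraph.Reachable.refl _⟩
    | succ n ih =>
      obtain ⟨hn, hr⟩ := ih
      have e : (c ^ (n + 1)) v = c ((c ^ n) v) := by rw [pow_succ', Perm.mul_apply]
      have hn' : (c ^ (n + 1)) v ∈ (cycSub G c).verts := by
        rw [e]
        intro h'
        exact hn (c.injective h')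
      refine ⟨hn', hr.trans (SimpleGraph.Adj.reachable ?_)⟩
      rw [SimpleGraph.Subgraph.coe_adj]
      exact (h.adj_iff hn).2 (Or.inl e)
  have key2 : ∀ x : (cycSub G c).verts, (cycSub G c).coe.Reachable ⟨v, hv⟩ x := by
    rintro ⟨x, hx⟩
    obtain ⟨n, rfl⟩ := h.1.1.exists_pow_eq h.1.2 hx
    exact (key n).2
  have : Nonempty (cycSub G c).verts := ⟨⟨v, hv⟩⟩
  exact ⟨fun x y => (key2 x).symm.trans (key2 y)⟩

lemma GoodPerm.inv (h : GoodPerm G v c) : GoodPerm G v c⁻¹ := by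
  have hh : ∀ i, c⁻¹ i ≠ i ↔ c i ≠ i := fun i => by
    rw [not_iff_not, Perm.inv_eq_iff_eq, eq_comm]
  refine ⟨⟨h.1.1.inv, (hh v).2 h.1.2⟩, ?_, ?_⟩
  · intro i hi
    exact ((h.adj_iff ((hh i).1 hi)).2 (Or.inr rfl)).1
  · intro h'
    rw [Perm.inv_eq_iff_eq, Perm.inv_eq_iff_eq] at h'
    exact h.2.2 h'.symm

lemma cycSub_inv : cycSub G c⁻¹ = cycSub G c := by
  ext a b
  · show c⁻¹ a ≠ a ↔ c a ≠ a
    rw [not_iff_not, Perm.inv_eq_iff_eq, eq_comm]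
  · show _ ∧ _ ↔ _ ∧ _
    rw [Perm.inv_eq_iff_eq, Perm.inv_eq_iff_eq]
    grind

lemma GoodPerm.unique (h : GoodPerm G v c) (h' : GoodPerm G v c')
    (he : cycSub G c' = cycSub G c) (hv : c' v = c v) : c' = c := by
  have hm : ∀ w, c' w ≠ w ↔ c w ≠ w := fun w => by
    have : w ∈ (cycSub G c').verts ↔ w ∈ (cycSub G c).verts := by rw [he]
    exact this
  have step : ∀ w, c w ≠ w → c' w = c w → c' (c w) = c (c w) := by
    intro w hw e
    have hcw : c (c w) ≠ c w := fun h2 => hw (c.injective h2)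
    have ha : (cycSub G c).Adj (c w) (c' (c w)) := by
      rw [← he]
      exact (h'.adj_iff ((hm _).2 hcw)).2 (Or.inl rfl)
    rcases (h.adj_iff hcw).1 ha with h3 | h3
    · exact h3
    · exfalso
      rw [Perm.eq_inv_iff_eq] at h3
      have h4 := c.injective h3
      rw [← e] at h4
      exact h'.sq_ne ((hm w).2 hw) h4
  have all : ∀ n : ℕ, c ((c ^ n) v) ≠ (c ^ n) v ∧ c' ((c ^ n) v) = c ((c ^ n) v) := by
    intro n
    induction n with
    | zero => exact ⟨h.1.2, hv⟩
    | succ n ih =>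
      rw [pow_succ', Perm.mul_apply]
      exact ⟨fun h2 => ih.1 (c.injective h2), step _ ih.1 ih.2⟩
  ext w
  by_cases hw : c w = w
  · rw [hw]
    by_contra h2
    exact (hm w).1 h2 hw
  · obtain ⟨n, rfl⟩ := h.1.1.exists_pow_eq h.1.2 hw
    exact (all n).2

lemma exists_goodPerm {C : G.Subgraph} (hC : IsCycleSub G C) (hv : v ∈ C.verts) :
    ∃ c, GoodPerm G v c ∧ cycSub G c = C := by
  obtain ⟨hconn, -, hdeg⟩ := hC
  have hcyc : C.spanningCoe.IsCycles := by
    rintro w ⟨u, hu⟩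
    exact hdeg w (C.edge_vert hu)
  have hn : (C.spanningCoe.neighborSet v).Nonempty := by
    have h2 := hdeg v hv
    have : (C.neighborSet v).Nonempty := by
      apply Set.nonempty_of_ncard_ne_zero; omega
    exact this
  obtain ⟨p, hp, hpv⟩ := hcyc.exists_cycle_toSubgraph_verts_eq_connectedComponentSupp
    (c := C.spanningCoe.connectedComponentMk v) rfl hn
  have hsupp : ∀ w, w ∈ p.support ↔ w ∈ C.verts := by
    intro w
    rw [← SimpleGraph.Walk.mem_verts_toSubgraph, hpv, SimpleGraph.ConnectedComponent.mem_supp_iff,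
      SimpleGraph.ConnectedComponent.eq]
    constructor
    · rintro ⟨q⟩
      cases q with
      | nil => exact hv
      | cons h _ => exact C.edge_vert h
    · intro hw
      have hr := (SimpleGraph.Subgraph.connected_iff'.1 hconn).preconnected ⟨w, hw⟩ ⟨v, hv⟩
      exact hr.map (⟨Subtype.val, fun h => h⟩ : C.coe →g C.spanningCoe)
  have h3 := hp.three_le_length
  set l := p.support.tail with hl
  have hnd : l.Nodup := hp.support_nodup
  have hlen : l.length = p.length := by simp [hl]
  have hget : ∀ i (hi : i < l.length), l[i] = p.getVert (i + 1) := by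
    intro i hi
    simp only [hl, List.getElem_tail]
    rw [SimpleGraph.Walk.support_getElem_eq_getVert]
  have hmem : ∀ w, w ∈ l ↔ w ∈ C.verts := by
    intro w
    rw [← hsupp, SimpleGraph.Walk.mem_support_iff]
    constructor
    · exact Or.inr
    · rintro (rfl | h)
      · have : l[p.length - 1]'(by omega) = w := by
          rw [hget, Nat.sub_add_cancel (by omega), SimpleGraph.Walk.getVert_length]
        rw [← this]; exact List.getElem_mem _
      · exact h
  have hne1 : ∀ x, l ≠ [x] := by
    intro x hx
    rw [hx] at hlen; simp at hlen; omega
  have hs : l.formPerm.support = l.toFinset := List.support_formPerm_of_nodup l hnd hne1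
  have hverts : ∀ w, l.formPerm w ≠ w ↔ w ∈ C.verts := by
    intro w
    rw [← mem_support, hs, List.mem_toFinset, hmem]
  have hadj : ∀ w, l.formPerm w ≠ w → C.Adj w (l.formPerm w) := by
    intro w hw
    rw [hverts, ← hmem] at hw
    obtain ⟨i, hi, rfl⟩ := List.getElem_of_mem hw
    rw [List.formPerm_apply_getElem l hnd i hi, hget, hget]
    rcases Nat.lt_or_ge (i + 1) l.length with h | h
    · rw [Nat.mod_eq_of_lt h]
      exact p.adj_getVert_succ (by omega)
    · have e : i + 1 = p.length := by omega
      rw [hlen, e, Nat.mod_self, SimpleGraph.Walk.getVert_length]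
      have := p.adj_getVert_succ (i := 0) (by omega)
      rwa [SimpleGraph.Walk.getVert_zero] at this
  have hcy : l.formPerm.IsCycle := List.isCycle_formPerm hnd (by omega)
  have hgood : GoodPerm G v l.formPerm := by
    refine ⟨⟨hcy, (hverts v).2 hv⟩, fun i hi => (hadj i hi).adj_sub, fun h => ?_⟩
    have e := hcy.eq_swap_of_apply_apply_eq_self ((hverts v).2 hv) h
    have hc2 : l.formPerm.support.card = 2 := by
      rw [e, card_support_swap]
      exact ((hverts v).2 hv).symm
    rw [hs, List.toFinset_card_of_nodup hnd] at hc2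
    omega
  refine ⟨_, hgood, ?_⟩
  have hsub : ∀ w, w ∈ C.verts → (cycSub G l.formPerm).neighborSet w = C.neighborSet w := by
    intro w hw
    have hw' := (hverts w).2 hw
    apply Set.eq_of_subset_of_ncard_le
    · rintro u ⟨hG, hu | hu⟩
      · have := hadj w hw'
        rwa [hu] at this
      · have := hadj u (by rw [hu]; exact hG.ne)
        rw [hu] at this
        exact this.symm
    · rw [hdeg w hw, hgood.ncard hw']
    · exact Set.toFinite _
  ext a b
  · exact hverts a
  · constructor
    · intro h
      have : b ∈ (cycSub G l.formPerm).neighborSet a := h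
      rwa [hsub a ((hverts a).1 ((cycSub G l.formPerm).edge_vert h))] at this
    · intro h
      have : b ∈ C.neighborSet a := h
      rwa [← hsub a (C.edge_vert h)] at this

lemma card_fiber {C : G.Subgraph} (hC : IsCycleSub G C) (hv : v ∈ C.verts) :
    (Finset.univ.filter fun c : Perm V => GoodPerm G v c ∧ cycSub G c = C).card = 2 := by
  obtain ⟨c, hc, rfl⟩ := exists_goodPerm hC hv
  have : (Finset.univ.filter fun c' : Perm V => GoodPerm G v c' ∧ cycSub G c' = cycSub G c) =
      {c, c⁻¹} := by
    ext c'
    simp only [Finset.mem_filter, Finset.mem_univ, true_and, Finset.mem_insert,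
      Finset.mem_singleton]
    constructor
    · rintro ⟨h1, h2⟩
      have ha : (cycSub G c').Adj v (c' v) := (h1.adj_iff h1.1.2).2 (Or.inl rfl)
      rw [h2, hc.adj_iff hc.1.2] at ha
      rcases ha with ha | ha
      · exact Or.inl (hc.unique h1 h2 ha)
      · exact Or.inr (hc.inv.unique h1 (h2.trans cycSub_inv.symm) ha)
    · rintro (rfl | rfl)
      · exact ⟨hc, rfl⟩
      · exact ⟨hc.inv, cycSub_inv⟩
  rw [this, Finset.card_pair]
  intro h
  exact hc.ne_inv hc.1.2 (congrArg (fun f : Perm V => f v) h)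

end

lemma phi_delSub {V : Type*} [Fintype V] [DecidableEq V] (Q : Matrix V V (Polynomial ℤ))
    (S : Set V) [Fintype {w : V // w ∉ S}] [DecidableEq {w : V // w ∉ S}] :
    phi (delSub Q S) =
      (delSub ((Polynomial.X : Polynomial ℤ) • (1 : Matrix V V (Polynomial ℤ)) - Q) S).det := by
  unfold phi
  congr 1
  ext1 i j
  simp [delSub, Matrix.one_apply, Subtype.ext_iff]

open Equiv Equiv.Perm in
lemma main_aux {V R : Type*} [Fintype V] [DecidableEq V] [CommRing R]
    (G : SimpleGraph V) (v : V) (F : Set V → R) :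
    ∑ c : Perm V with (c.IsCycle ∧ c v ≠ v) ∧ (∀ i, c i ≠ i → G.Adj i (c i)),
      F (c.support : Set V) =
    ∑ u ∈ Finset.univ.filter (fun u => G.Adj v u), F {u, v} +
      2 * ∑ᶠ C ∈ {C : G.Subgraph | IsCycleSub G C ∧ v ∈ C.verts}, F C.verts := by
  rw [← Finset.sum_filter_add_sum_filter_not _ (fun c : Perm V => c (c v) = v)]
  congr 1
  · refine Finset.sum_bij (fun c _ => c v) ?_ ?_ ?_ ?_
    · intro c hc
      simp only [Finset.mem_filter, Finset.mem_univ, true_and] at hc ⊢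
      exact hc.1.2 v hc.1.1.2
    · intro c hc c' hc' h
      simp only [Finset.mem_filter, Finset.mem_univ, true_and] at hc hc'
      rw [hc.1.1.1.eq_swap_of_apply_apply_eq_self hc.1.1.2 hc.2,
        hc'.1.1.1.eq_swap_of_apply_apply_eq_self hc'.1.1.2 hc'.2, h]
    · intro u hu
      simp only [Finset.mem_filter, Finset.mem_univ, true_and] at hu
      refine ⟨swap v u, ?_, by simp⟩
      simp only [Finset.mem_filter, Finset.mem_univ, true_and]
      refine ⟨⟨⟨isCycle_swap hu.ne, by simpa using hu.ne.symm⟩, ?_⟩, by simp⟩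
      intro i hi
      by_cases h1 : i = v
      · subst h1; simpa using hu
      · by_cases h2 : i = u
        · subst h2; simpa using hu.symm
        · exact absurd (swap_apply_of_ne_of_ne h1 h2) hi
    · intro c hc
      simp only [Finset.mem_filter, Finset.mem_univ, true_and] at hc
      congr 1
      have e := hc.1.1.1.eq_swap_of_apply_apply_eq_self hc.1.1.2 hc.2
      have : c.support = {v, c v} := by
        conv_lhs => rw [e]
        exact support_swap hc.1.1.2.symm
      rw [this]
      ext x; simp [or_comm]
  · have hfin : {C : G.Subgraph | IsCycleSub G C ∧ v ∈ C.verts}.Finite := Set.toFinite _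
    rw [finsum_mem_eq_finite_toFinset_sum _ hfin, Finset.filter_filter]
    have e : (Finset.univ.filter fun c : Perm V =>
        ((c.IsCycle ∧ c v ≠ v) ∧ (∀ i, c i ≠ i → G.Adj i (c i))) ∧ ¬ c (c v) = v) =
        Finset.univ.filter fun c : Perm V => GoodPerm G v c := by
      ext c
      simp only [Finset.mem_filter, Finset.mem_univ, true_and, GoodPerm, and_assoc]
    rw [e, ← Finset.sum_fiberwise_of_maps_to (g := fun c : Perm V => cycSub G c)
      (t := hfin.toFinset), Finset.mul_sum]
    · refine Finset.sum_congr rfl fun C hC => ?_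
      simp only [Set.Finite.mem_toFinset, Set.mem_ofPred_eq] at hC
      rw [Finset.filter_filter]
      rw [Finset.sum_congr rfl (g := fun _ => F C.verts), Finset.sum_const, card_fiber hC.1 hC.2]
      · simp
      · intro c hc
        simp only [Finset.mem_filter, Finset.mem_univ, true_and] at hc
        congr 1
        rw [← hc.2]
        ext x
        simp [cycSub]
    · intro c hc
      simp only [Finset.mem_filter, Finset.mem_univ, true_and] at hc
      simp only [Set.Finite.mem_toFinset, Set.mem_ofPred_eq]
      exact ⟨hc.isCycleSub, hc.1.2⟩

theorem signless_laplacian_charpoly_vertex_recursion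
    {V : Type*} [Fintype V] [DecidableEq V]
    (G : SimpleGraph V) [DecidableRel G.Adj] (v : V) :
    phi (qMat (Polynomial ℤ) G) =
      (Polynomial.X - (G.degree v : Polynomial ℤ)) * phi (delSub (qMat (Polynomial ℤ) G) {v})
        - ∑ u ∈ G.neighborFinset v, phi (delSub (qMat (Polynomial ℤ) G) {u, v})
        - 2 * ∑ᶠ C ∈ {C : G.Subgraph | IsCycleSub G C ∧ v ∈ C.verts},
          phi (delSub (qMat (Polynomial ℤ) G) C.verts) := by
  have hF := main_aux G v (fun S : Set V => phi (delSub (qMat (Polynomial ℤ) G) S))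
  set Q := qMat (Polynomial ℤ) G with hQ
  have hdiag : ((Polynomial.X : Polynomial ℤ) • (1 : Matrix V V (Polynomial ℤ)) - Q) v v =
      Polynomial.X - (G.degree v : Polynomial ℤ) := by
    simp [hQ, qMat, degMat]
  have hoff : ∀ i j, i ≠ j →
      ((Polynomial.X : Polynomial ℤ) • (1 : Matrix V V (Polynomial ℤ)) - Q) i j =
        if G.Adj i j then -1 else 0 := by
    intro i j hij
    by_cases h : G.Adj i j <;> simp [hQ, qMat, degMat, hij, h]
  have hN : G.neighborFinset v = Finset.univ.filter (fun u => G.Adj v u) := by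
    ext u; simp
  have h1 : phi Q = _ := det_expand _ v
  rw [h1, hdiag, ← phi_delSub, hN]
  have h2 : ∀ a c d e : Polynomial ℤ, d + e = -c → a + c = a - d - e := by
    intro a c d e h
    linear_combination h
  apply h2
  refine Eq.trans (b := ∑ c : Equiv.Perm V with
      (c.IsCycle ∧ c v ≠ v) ∧ (∀ i, c i ≠ i → G.Adj i (c i)),
      phi (delSub Q (c.support : Set V))) ?_ ?_
  · convert hF.symm
  · rw [← Finset.sum_neg_distrib]
    rw [← Finset.filter_filter]
    refine (Finset.sum_filter _ _).trans ?_
    refine Finset.sum_congr rfl fun c hc => ?_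
    simp only [Finset.mem_filter, Finset.mem_univ, true_and] at hc
    rw [← phi_delSub]
    split_ifs with h
    · have hp : ∏ i ∈ c.support,
          ((Polynomial.X : Polynomial ℤ) • (1 : Matrix V V (Polynomial ℤ)) - Q) (c i) i =
          (-1) ^ c.support.card := by
        rw [← Finset.prod_const]
        refine Finset.prod_congr rfl fun i hi => ?_
        have hi' := Equiv.Perm.mem_support.1 hi
        rw [hoff _ _ hi', if_pos (h i hi').symm]
      rw [hp, hc.1.sign]
      push_cast
      have : ((-1 : Polynomial ℤ) ^ c.support.card) * (-1) ^ c.support.card = 1 := by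
        rw [← mul_pow]; simp
      linear_combination (-phi (delSub Q (c.support : Set V))) * this
    · push Not at h
      obtain ⟨i, hi, hn⟩ := h
      rw [Finset.prod_eq_zero (Equiv.Perm.mem_support.2 hi)]
      · simp
      · rw [hoff _ _ hi, if_neg fun h => hn h.symm]
end
end
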